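/- Let J(u) = ∫_u^∞ e^{−t}/t dt for u > 0, and let h(z) = ξ(e^z − 1) with Laplace transform ĥ(s) = ∫₀^∞ h(z) e^{−sz} dz. Then for every complex number s with Re s > 1, the integral Q(s) = ∫₀^∞ u^s (e^{2J(u)} − 1) du converges and (s + 1) Q(s) = 2 Γ(s+1) (1 + ĥ(s)), where Γ is the Gamma function. -/

import Mathlib

open Real MeasureTheory

/-- `J(u) = ∫_u^∞ e^{-t}/t dt`. -/
noncomputable def J (u : ℝ) : ℝ :=
  ∫ t in Set.Ioi u, Real.exp (-t) / t

open Set Filter Topology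

lemma xi_eq (ξ : ℝ → ℝ) (hξ0 : ∀ u : ℝ, u < 1 → ξ u = 0)
    (hξ : ∀ u : ℝ, 1 ≤ u → u * ξ u = 2 + 2 * ∫ t in (1:ℝ)..(u - 1), ξ t) (u : ℝ) (hu : 1 ≤ u) :
    u * ξ u = 2 + 2 * ∫ t in Ioc 1 (u - 1), ξ t := by
  rw [hξ u hu]
  rcases le_total 2 u with h | h
  · rw [intervalIntegral.integral_of_le (by linarith)]
  · have e : Ioc 1 (u - 1) = ∅ := Set.Ioc_eq_empty (not_lt.2 (by linarith))
    rw [intervalIntegral.integral_of_ge (by linarith), e, integral_Ioc_eq_integral_Ioo,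
      setIntegral_eq_zero_of_forall_eq_zero]
    · simp
    · intro x hx; exact hξ0 x hx.2

lemma xi_integrable (ξ : ℝ → ℝ) (hξ0 : ∀ u : ℝ, u < 1 → ξ u = 0)
    (h : ∀ u : ℝ, 1 ≤ u → u * ξ u = 2 + 2 * ∫ t in (1:ℝ)..(u - 1), ξ t) (n : ℕ) :
    IntegrableOn ξ (Icc 0 (n + 1)) := by
  have h0 : IntegrableOn ξ (Icc 0 1) := by
    rw [integrableOn_Icc_iff_integrableOn_Ico]
    refine (integrableOn_zero).congr_fun (f := fun _ => (0:ℝ)) ?_ measurableSet_Ico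
    intro x hx; exact (hξ0 x hx.2).symm
  induction n with
  | zero => simpa using h0
  | succ n ih =>
    have hn : (0:ℝ) ≤ n := n.cast_nonneg
    have hc : ContinuousOn (fun x => ∫ t in (1:ℝ)..x, ξ t) (Icc 0 ((n:ℝ) + 1)) := by
      have := intervalIntegral.continuousOn_primitive_interval' (f := ξ) (μ := volume) (a := 1)
        (b₁ := 0) (b₂ := (n:ℝ)+1) ?_ ?_
      · rwa [uIcc_of_le (by linarith)] at this
      · rw [intervalIntegrable_iff_integrableOn_Icc_of_le (by linarith)]; exact ih
      · rw [uIcc_of_le (by linarith)]; constructor <;> linarith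
    have hc2 : ContinuousOn ξ (Icc 1 ((n:ℝ) + 2)) := by
      have : ContinuousOn (fun u => (2 + 2 * ∫ t in (1:ℝ)..(u - 1), ξ t) / u) (Icc 1 ((n:ℝ) + 2)) := by
        refine ContinuousOn.div ?_ continuousOn_id ?_
        · refine continuousOn_const.add (continuousOn_const.mul ?_)
          refine hc.comp (f := fun u : ℝ => u - 1) (by fun_prop) ?_
          intro u hu
          simp only [mem_Icc] at hu ⊢
          constructor <;> linarith
        · intro u hu; simp only [mem_Icc] at hu; show u ≠ 0; linarith
      refine this.congr ?_
      intro u hu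
      have h1 : 1 ≤ u := hu.1
      simp only; rw [← h u h1]; field_simp
    have := h0.union (hc2.integrableOn_Icc)
    rw [Icc_union_Icc_eq_Icc (by linarith) (by linarith)] at this
    push_cast
    rwa [show (n:ℝ) + 1 + 1 = n + 2 by ring]

lemma xi_integrable' (ξ : ℝ → ℝ) (hξ0 : ∀ u : ℝ, u < 1 → ξ u = 0)
    (h : ∀ u : ℝ, 1 ≤ u → u * ξ u = 2 + 2 * ∫ t in (1:ℝ)..(u - 1), ξ t) (x : ℝ) :
    IntegrableOn ξ (Ioc 1 x) := by
  obtain ⟨n, hn⟩ := exists_nat_ge x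
  refine (xi_integrable ξ hξ0 h n).mono_set ?_
  intro y hy; exact ⟨by linarith [hy.1], by linarith [hy.2]⟩

lemma xi_measurable (ξ : ℝ → ℝ) (hξ0 : ∀ u : ℝ, u < 1 → ξ u = 0)
    (h : ∀ u : ℝ, 1 ≤ u → u * ξ u = 2 + 2 * ∫ t in (1:ℝ)..(u - 1), ξ t) :
    Measurable ξ := by
  have hI : ∀ a b, IntervalIntegrable ξ volume a b := by
    intro a b
    obtain ⟨n, hn⟩ := exists_nat_ge (max a b)
    have h1 : IntegrableOn ξ (Iio 1) := by
      refine (integrableOn_zero).congr_fun (f := fun _ => (0:ℝ)) ?_ measurableSet_Iio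
      intro x hx; exact (hξ0 x hx).symm
    refine ((h1.union (xi_integrable ξ hξ0 h n)).mono_set ?_).intervalIntegrable
    intro y hy
    have hy2 : y ≤ max a b := hy.2
    rcases lt_or_ge y 1 with h | h
    · left; exact h
    · right; exact ⟨by linarith, by linarith⟩
  have hc := intervalIntegral.continuous_primitive hI 1
  have : ξ = (Ici 1).indicator (fun u => (2 + 2 * ∫ t in (1:ℝ)..(u - 1), ξ t) / u) := by
    ext u
    by_cases hu : 1 ≤ u
    · rw [indicator_of_mem (by exact hu), ← h u hu]; field_simp
    · rw [indicator_of_notMem (by exact hu), hξ0 u (by linarith)]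
  rw [this]
  refine Measurable.indicator ?_ measurableSet_Ici
  have := (hc.comp (continuous_id.sub continuous_const : Continuous fun u : ℝ => u - 1)).measurable
  exact ((this.const_mul 2).const_add 2).div measurable_id

lemma xi_bound (ξ : ℝ → ℝ) (hξ0 : ∀ u : ℝ, u < 1 → ξ u = 0)
    (h : ∀ u : ℝ, 1 ≤ u → u * ξ u = 2 + 2 * ∫ t in (1:ℝ)..(u - 1), ξ t) (u : ℝ) :
    0 ≤ ξ u ∧ ξ u ≤ 2 * |u| := by
  have key : ∀ n : ℕ, ∀ u : ℝ, u < n + 1 → 0 ≤ ξ u ∧ ξ u ≤ 2 * |u| := by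
    intro n
    induction n with
    | zero => intro u hu; rw [hξ0 u (by simpa using hu)]; simp
    | succ n ih =>
      intro u hu
      push_cast at hu
      rcases lt_or_ge u 1 with h1 | h1
      · rw [hξ0 u h1]; simp
      have e := xi_eq ξ hξ0 h u h1
      have b : 0 ≤ (∫ t in Ioc 1 (u - 1), ξ t) ∧ (∫ t in Ioc 1 (u - 1), ξ t) ≤ u^2 - 1 := by
        constructor
        · exact setIntegral_nonneg measurableSet_Ioc fun x hx => (ih x (by linarith [hx.2])).1
        · rcases le_total 2 u with h2 | h2
          · calc (∫ t in Ioc 1 (u - 1), ξ t) ≤ ∫ t in Ioc 1 (u - 1), 2 * t := by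
                  refine setIntegral_mono_on (xi_integrable' ξ hξ0 h _) ?_ measurableSet_Ioc ?_
                  · exact (Continuous.integrableOn_Icc (by fun_prop)).mono_set Ioc_subset_Icc_self
                  · intro x hx
                    have := (ih x (by linarith [hx.2])).2
                    rwa [abs_of_pos (by linarith [hx.1])] at this
              _ = (u-1)^2 - 1 := by
                  rw [← intervalIntegral.integral_of_le (by linarith), intervalIntegral.integral_const_mul, integral_id]; ring
              _ ≤ _ := by nlinarith
          · rw [Ioc_eq_empty (by simp; linarith), Measure.restrict_empty, integral_zero_measure]; nlinarith
      rw [abs_of_pos (by linarith)]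
      constructor
      · by_contra hneg
        nlinarith
      · by_contra hneg
        nlinarith
  obtain ⟨n, hn⟩ := exists_nat_gt u
  exact key n u (by linarith)

lemma G_le (ξ : ℝ → ℝ) (hξ0 : ∀ u : ℝ, u < 1 → ξ u = 0)
    (h : ∀ u : ℝ, 1 ≤ u → u * ξ u = 2 + 2 * ∫ t in (1:ℝ)..(u - 1), ξ t) (u : ℝ) (hu : 1 ≤ u) :
    (∫ t in Ioc 1 (u - 1), ξ t) ≤ u ^ 2 := by
  have := xi_eq ξ hξ0 h u hu
  have h2 := (xi_bound ξ hξ0 h u).2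
  rw [abs_of_pos (by linarith)] at h2
  nlinarith

/-- Fubini step -/
lemma fubini_xi {E : Type*} [NormedAddCommGroup E] [NormedSpace ℝ E] [CompleteSpace E]
    (ξ : ℝ → ℝ) (hξ0 : ∀ u : ℝ, u < 1 → ξ u = 0)
    (h : ∀ u : ℝ, 1 ≤ u → u * ξ u = 2 + 2 * ∫ t in (1:ℝ)..(u - 1), ξ t)
    (w : ℝ → E) (hw : AEStronglyMeasurable w (volume.restrict (Ioi 1)))
    (hi : IntegrableOn (fun t => t ^ 2 * ‖w t‖) (Ioi 1)) :
    ∫ t in Ioi 1, (t * ξ t) • w t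
      = (2:ℝ) • (∫ t in Ioi 1, w t) + (2:ℝ) • ∫ v in Ioi 1, ξ v • ∫ t in Ioi (v + 1), w t := by
  set μ := volume.restrict (Ioi (1:ℝ)) with hμ
  have hm := xi_measurable ξ hξ0 h
  have hb := xi_bound ξ hξ0 h
  let f : ℝ → ℝ → E := fun t v => {p : ℝ × ℝ | p.2 + 1 ≤ p.1}.indicator (fun p => ξ p.2 • w p.1) (t, v)
  have fl : ∀ t v, f t v = (Iic (t - 1)).indicator (fun v => ξ v • w t) v := by
    intro t v
    simp only [f, indicator, mem_ofPred_eq, mem_Iic, le_sub_iff_add_le]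
  have fr : ∀ t v, f t v = (Ici (v + 1)).indicator (fun t => ξ v • w t) t := by
    intro t v
    simp only [f, indicator, mem_ofPred_eq, mem_Ici]
  have hwi : Integrable w μ := by
    refine Integrable.mono' hi hw ?_
    refine (ae_restrict_iff' measurableSet_Ioi).2 (.of_forall fun t ht => ?_)
    have : (1:ℝ) < t := ht
    have h2 : 1 ≤ t ^ 2 := by nlinarith
    exact le_mul_of_one_le_left (norm_nonneg _) h2
  have hfm : AEStronglyMeasurable (Function.uncurry f) (μ.prod μ) := by
    have : Function.uncurry f = {p : ℝ × ℝ | p.2 + 1 ≤ p.1}.indicator (fun p => ξ p.2 • w p.1) := by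
      ext ⟨t, v⟩; rfl
    rw [this]
    refine AEStronglyMeasurable.indicator ?_ (measurableSet_le (by fun_prop) (by fun_prop))
    exact (hm.comp measurable_snd).aestronglyMeasurable.smul (hw.comp_fst)
  have inner : ∀ t, ∫ v, f t v ∂μ = (∫ v in Ioc 1 (t - 1), ξ v) • w t := by
    intro t
    simp_rw [fl]
    rw [hμ, setIntegral_indicator measurableSet_Iic, Ioi_inter_Iic, integral_smul_const]
  have inner2 : ∀ t, ∫ v, ‖f t v‖ ∂μ = (∫ v in Ioc 1 (t - 1), ξ v) * ‖w t‖ := by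
    intro t
    simp_rw [fl, norm_indicator_eq_indicator_norm, norm_smul, Real.norm_eq_abs, abs_of_nonneg (hb _).1]
    rw [hμ, setIntegral_indicator measurableSet_Iic, Ioi_inter_Iic, integral_mul_const]
  have hfi : Integrable (Function.uncurry f) (μ.prod μ) := by
    rw [integrable_prod_iff hfm]
    constructor
    · refine .of_forall fun t => ?_
      simp only [Function.uncurry_apply_pair, fl]
      rw [integrable_indicator_iff measurableSet_Iic, IntegrableOn, hμ, Measure.restrict_restrict measurableSet_Iic,
        Iic_inter_Ioi]
      exact (xi_integrable' ξ hξ0 h _).smul_const _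
    · refine Integrable.mono' hi hfm.norm.integral_prod_right' ?_
      refine (ae_restrict_iff' measurableSet_Ioi).2 (.of_forall fun t ht => ?_)
      simp only [Function.uncurry_apply_pair]
      rw [inner2, Real.norm_eq_abs, abs_of_nonneg]
      · exact mul_le_mul_of_nonneg_right (G_le ξ hξ0 h t (le_of_lt ht)) (norm_nonneg _)
      · exact mul_nonneg (setIntegral_nonneg measurableSet_Ioc fun x _ => (hb x).1) (norm_nonneg _)
  have hGi : Integrable (fun t => (∫ v in Ioc 1 (t - 1), ξ v) • w t) μ := by
    simpa only [Function.uncurry_apply_pair, inner] using hfi.integral_prod_left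
  have sw := integral_integral_swap hfi
  simp_rw [inner] at sw
  have e1 : ∫ t in Ioi 1, (t * ξ t) • w t
      = ∫ t in Ioi 1, ((2:ℝ) • w t + (2:ℝ) • ((∫ v in Ioc 1 (t - 1), ξ v) • w t)) := by
    refine setIntegral_congr_fun measurableSet_Ioi fun t ht => ?_
    rw [xi_eq ξ hξ0 h t (le_of_lt ht), add_smul, mul_smul]
  rw [← hμ] at e1
  have e2 : ∫ t, ((2:ℝ) • w t + (2:ℝ) • ((∫ v in Ioc 1 (t - 1), ξ v) • w t)) ∂μ = ∫ t, (2:ℝ) • w t ∂μ + ∫ t, (2:ℝ) • ((∫ v in Ioc 1 (t - 1), ξ v) • w t) ∂μ :=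
    integral_add (hwi.smul (2:ℝ)) (hGi.smul (2:ℝ))
  rw [e1, e2, integral_smul, integral_smul, sw]
  congr 2
  refine setIntegral_congr_fun measurableSet_Ioi fun v hv => ?_
  have : (1:ℝ) < v := hv
  simp_rw [fr]
  rw [hμ, setIntegral_indicator measurableSet_Ici, inter_eq_right.2, integral_Ici_eq_integral_Ioi, integral_smul]
  intro x hx
  have : v + 1 ≤ x := hx
  show 1 < x
  linarith

lemma exp_int (p : ℝ) (hp : 0 < p) : IntegrableOn (fun t : ℝ => t ^ 2 * Real.exp (-(p * t))) (Ioi 1) := by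
  have := integrableOn_rpow_mul_exp_neg_mul_rpow (s := 2) (p := 1) (b := p) (by norm_num) one_pos hp
  refine (this.mono_set (Ioi_subset_Ioi zero_le_one)).congr_fun ?_ measurableSet_Ioi
  intro t _
  simp

lemma xi_le_sq (ξ : ℝ → ℝ) (hξ0 : ∀ u : ℝ, u < 1 → ξ u = 0)
    (h : ∀ u : ℝ, 1 ≤ u → u * ξ u = 2 + 2 * ∫ t in (1:ℝ)..(u - 1), ξ t) (t : ℝ) (ht : 1 < t) :
    ξ t ≤ 2 * t ^ 2 ∧ t * ξ t ≤ 2 * t ^ 2 := by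
  have h2 := (xi_bound ξ hξ0 h t).2
  rw [abs_of_pos (by linarith)] at h2
  constructor <;> nlinarith

lemma X_int (ξ : ℝ → ℝ) (hξ0 : ∀ u : ℝ, u < 1 → ξ u = 0)
    (h : ∀ u : ℝ, 1 ≤ u → u * ξ u = 2 + 2 * ∫ t in (1:ℝ)..(u - 1), ξ t) (p : ℝ) (hp : 0 < p) :
    IntegrableOn (fun t : ℝ => ξ t * Real.exp (-(p * t))) (Ioi 1) := by
  have hm := xi_measurable ξ hξ0 h
  refine Integrable.mono' ((exp_int p hp).const_mul 2) (by fun_prop) ?_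
  refine (ae_restrict_iff' measurableSet_Ioi).2 (.of_forall fun t ht => ?_)
  rw [Real.norm_eq_abs, abs_of_nonneg (mul_nonneg (xi_bound ξ hξ0 h t).1 (Real.exp_pos _).le), ← mul_assoc]
  exact mul_le_mul_of_nonneg_right (xi_le_sq ξ hξ0 h t ht).1 (Real.exp_pos _).le

lemma X_deriv (ξ : ℝ → ℝ) (hξ0 : ∀ u : ℝ, u < 1 → ξ u = 0)
    (h : ∀ u : ℝ, 1 ≤ u → u * ξ u = 2 + 2 * ∫ t in (1:ℝ)..(u - 1), ξ t) (p : ℝ) (hp : 0 < p) :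
    HasDerivAt (fun p => ∫ t in Ioi 1, ξ t * Real.exp (-(p * t)))
      (-(2 * (Real.exp (-p) / p) * (1 + ∫ t in Ioi 1, ξ t * Real.exp (-(p * t))))) p := by
  have hm := xi_measurable ξ hξ0 h
  have hd := (hasDerivAt_integral_of_dominated_loc_of_deriv_le (μ := volume.restrict (Ioi (1:ℝ)))
    (F := fun p t => ξ t * Real.exp (-(p * t))) (F' := fun p t => ξ t * (Real.exp (-(p * t)) * (-t)))
    (bound := fun t => 2 * (t ^ 2 * Real.exp (-(p / 2 * t)))) (s := Ioi (p / 2)) (x₀ := p)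
    (Ioi_mem_nhds (by linarith)) (.of_forall fun x => by fun_prop) (X_int ξ hξ0 h p hp)
    (by fun_prop) ?_ ((exp_int (p / 2) (by linarith)).const_mul 2) ?_).2
  · refine hd.congr_deriv ?_
    have hf := fubini_xi ξ hξ0 h (fun t => Real.exp (-(p * t))) (by fun_prop)
      (by simpa using exp_int p hp)
    have hI : ∀ c : ℝ, ∫ t in Ioi c, Real.exp (-(p * t)) = Real.exp (-(p * c)) / p := by
      intro c
      have := integral_exp_mul_Ioi (a := -p) (by linarith) c
      simp only [neg_mul, neg_div_neg_eq] at this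
      exact this
    simp only [hI, smul_eq_mul] at hf
    have e1 : ∫ t in Ioi 1, ξ t * (Real.exp (-(p * t)) * (-t)) = - ∫ t in Ioi 1, t * ξ t * Real.exp (-(p * t)) := by
      rw [← integral_neg]; congr 1; ext t; ring
    have e2 : ∫ t in Ioi 1, ξ t * (Real.exp (-(p * (t + 1))) / p)
        = (Real.exp (-p) / p) * ∫ t in Ioi 1, ξ t * Real.exp (-(p * t)) := by
      rw [← integral_const_mul]; congr 1; ext t
      rw [show -(p * (t + 1)) = -p + -(p * t) by ring, Real.exp_add]; ring
    rw [e1, hf, e2, mul_one]; ring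
  · refine (ae_restrict_iff' measurableSet_Ioi).2 (.of_forall fun t ht x hx => ?_)
    have h1 : (1:ℝ) < t := ht
    have hx : p / 2 < x := hx
    rw [norm_mul, norm_mul, norm_neg, Real.norm_eq_abs, Real.norm_eq_abs, Real.norm_eq_abs,
      abs_of_nonneg (xi_bound ξ hξ0 h t).1, Real.abs_exp, abs_of_pos (by linarith : (0:ℝ) < t)]
    calc _ = t * ξ t * Real.exp (-(x * t)) := by ring
      _ ≤ 2 * t ^ 2 * Real.exp (-(p / 2 * t)) := by
        refine mul_le_mul (xi_le_sq ξ hξ0 h t ht).2 ?_ (Real.exp_pos _).le (by positivity)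
        rw [Real.exp_le_exp]
        nlinarith
      _ = _ := by ring
  · refine .of_forall fun t x _ => ?_
    have : HasDerivAt (fun x : ℝ => -(x * t)) (-t) x := by
      have h3 := ((hasDerivAt_id x).mul_const t).neg
      rw [one_mul] at h3
      exact h3
    exact (this.exp).const_mul _

lemma J_integrable (a : ℝ) (ha : 0 < a) : IntegrableOn (fun t : ℝ => Real.exp (-t) / t) (Ioi a) := by
  refine Integrable.mono' ((integrableOn_exp_neg_Ioi a).div_const a) (by fun_prop : Measurable (fun t : ℝ => Real.exp (-t) / t)).aestronglyMeasurable ?_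
  refine (ae_restrict_iff' measurableSet_Ioi).2 (.of_forall fun t ht => ?_)
  have h1 : a < t := ht
  rw [Real.norm_eq_abs, abs_of_pos (div_pos (Real.exp_pos _) (by linarith))]
  exact div_le_div_of_nonneg_left (Real.exp_pos _).le ha h1.le

lemma J_deriv (u : ℝ) (hu : 0 < u) : HasDerivAt J (-(Real.exp (-u) / u)) u := by
  have h1 : HasDerivAt (fun x => J (u / 2) - ∫ t in (u / 2)..x, Real.exp (-t) / t) (-(Real.exp (-u) / u)) u := by
    refine HasDerivAt.const_sub _ ?_
    refine intervalIntegral.integral_hasDerivAt_right ?_ ?_ ?_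
    · rw [intervalIntegrable_iff_integrableOn_Ioc_of_le (by linarith)]
      exact (J_integrable (u/2) (by linarith)).mono_set Ioc_subset_Ioi_self
    · exact (by fun_prop : Measurable (fun t : ℝ => Real.exp (-t) / t)).stronglyMeasurable.stronglyMeasurableAtFilter
    · exact ContinuousAt.div (by fun_prop) continuousAt_id hu.ne'
  refine h1.congr_of_eventuallyEq ?_
  filter_upwards [Ioi_mem_nhds (show u / 2 < u by linarith)] with x hx
  have := intervalIntegral.integral_Ioi_sub_Ioi (J_integrable (u/2) (by linarith)) (le_of_lt hx)
  rw [← this]; simp only [J]; ring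

lemma J_tendsto : Tendsto J atTop (𝓝 0) := by
  have h0 : Tendsto (fun u : ℝ => Real.exp (-u)) atTop (𝓝 0) := Real.tendsto_exp_neg_atTop_nhds_zero
  refine squeeze_zero' ?_ ?_ h0
  · filter_upwards [eventually_ge_atTop 1] with u hu
    refine setIntegral_nonneg measurableSet_Ioi fun t ht => ?_
    have : u < t := ht
    exact div_nonneg (Real.exp_pos _).le (by linarith)
  · filter_upwards [eventually_ge_atTop 1] with u hu
    rw [← integral_exp_neg_Ioi u]
    refine setIntegral_mono_on (J_integrable u (by linarith)) (integrableOn_exp_neg_Ioi u) measurableSet_Ioi fun t ht => ?_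
    have : u < t := ht
    exact div_le_self (Real.exp_pos _).le (by linarith)

lemma X_tendsto (ξ : ℝ → ℝ) (hξ0 : ∀ u : ℝ, u < 1 → ξ u = 0)
    (h : ∀ u : ℝ, 1 ≤ u → u * ξ u = 2 + 2 * ∫ t in (1:ℝ)..(u - 1), ξ t) :
    Tendsto (fun p => ∫ t in Ioi 1, ξ t * Real.exp (-(p * t))) atTop (𝓝 0) := by
  have h0 : Tendsto (fun u : ℝ => Real.exp (-u) * (Real.exp 1 * ∫ t in Ioi 1, ξ t * Real.exp (-(1 * t)))) atTop (𝓝 0) := by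
    simpa using Real.tendsto_exp_neg_atTop_nhds_zero.mul_const (Real.exp 1 * ∫ t in Ioi 1, ξ t * Real.exp (-(1 * t)))
  refine squeeze_zero' ?_ ?_ h0
  · refine .of_forall fun u => setIntegral_nonneg measurableSet_Ioi fun t ht =>
      mul_nonneg (xi_bound ξ hξ0 h t).1 (Real.exp_pos _).le
  · filter_upwards [eventually_ge_atTop 1] with u hu
    rw [← mul_assoc, ← integral_const_mul]
    refine setIntegral_mono_on (X_int ξ hξ0 h u (by linarith)) ((X_int ξ hξ0 h 1 one_pos).const_mul _) measurableSet_Ioi fun t ht => ?_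
    have : 1 < t := ht
    rw [← Real.exp_add, mul_left_comm, ← Real.exp_add]
    refine mul_le_mul_of_nonneg_left ?_ (xi_bound ξ hξ0 h t).1
    rw [Real.exp_le_exp]
    nlinarith

lemma X_eq (ξ : ℝ → ℝ) (hξ0 : ∀ u : ℝ, u < 1 → ξ u = 0)
    (h : ∀ u : ℝ, 1 ≤ u → u * ξ u = 2 + 2 * ∫ t in (1:ℝ)..(u - 1), ξ t) (p : ℝ) (hp : 0 < p) :
    ∫ t in Ioi 1, ξ t * Real.exp (-(p * t)) = Real.exp (2 * J p) - 1 := by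
  set X := fun p => ∫ t in Ioi 1, ξ t * Real.exp (-(p * t)) with hX
  let Y := fun p => (1 + X p) * Real.exp (-(2 * J p))
  have hY : ∀ x ∈ Ioi (0:ℝ), HasDerivAt Y 0 x := by
    intro x hx
    have h1 := ((X_deriv ξ hξ0 h x hx).const_add 1).mul ((((J_deriv x hx).const_mul 2).neg).exp)
    refine h1.congr_deriv ?_
    ring
  have hlim : Tendsto Y atTop (𝓝 1) := by
    have h1 : Tendsto (fun p => (1 + X p) * Real.exp (-(2 * J p))) atTop (𝓝 ((1 + 0) * Real.exp (-(2 * 0)))) := by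
      refine ((X_tendsto ξ hξ0 h).const_add 1).mul ?_
      exact (Real.continuous_exp.tendsto _).comp ((J_tendsto.const_mul 2).neg)
    simpa using h1
  have hc : ∀ x ∈ Ioi (0:ℝ), Y x = Y p := by
    intro x hx
    refine isOpen_Ioi.is_const_of_deriv_eq_zero isPreconnected_Ioi (s := Ioi (0:ℝ)) (𝕜 := ℝ) (f := Y) ?_ ?_ hx hp
    · exact fun y hy => (hY y hy).differentiableAt.differentiableWithinAt
    · exact fun y hy => (hY y hy).deriv
  have h1 : Y p = 1 := by
    refine tendsto_nhds_unique (f := Y) (l := atTop) ?_ hlim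
    refine tendsto_const_nhds.congr' ?_
    filter_upwards [eventually_gt_atTop 0] with x hx
    exact (hc x hx).symm
  have h2 : (1 + X p) * Real.exp (-(2 * J p)) = 1 := h1
  rw [Real.exp_neg, ← div_eq_mul_inv, div_eq_one_iff_eq (Real.exp_pos _).ne'] at h2
  show X p = _
  linarith

lemma mellin_part (ξ : ℝ → ℝ) (hξ0 : ∀ u : ℝ, u < 1 → ξ u = 0)
    (h : ∀ u : ℝ, 1 ≤ u → u * ξ u = 2 + 2 * ∫ t in (1:ℝ)..(u - 1), ξ t) (s : ℂ) (hs : 1 < s.re) :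
    IntegrableOn (fun u : ℝ => (u : ℂ) ^ s * ((Real.exp (2 * J u) - 1 : ℝ) : ℂ)) (Set.Ioi 0) ∧
    ∫ u in Set.Ioi (0:ℝ), (u : ℂ) ^ s * ((Real.exp (2 * J u) - 1 : ℝ) : ℂ)
      = Complex.Gamma (s + 1) * ∫ t in Ioi (1:ℝ), (ξ t : ℂ) * (t : ℂ) ^ (-s - 1) := by
  have hm := xi_measurable ξ hξ0 h
  have hb := xi_bound ξ hξ0 h
  set μ := volume.restrict (Ioi (0:ℝ)) with hμ
  set ν := volume.restrict (Ioi (1:ℝ)) with hν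
  let f : ℝ → ℝ → ℂ := fun u t => (u : ℂ) ^ s * ((ξ t * Real.exp (-(u * t)) : ℝ) : ℂ)
  have hfm : AEStronglyMeasurable (Function.uncurry f) (μ.prod ν) := by
    have : Measurable (Function.uncurry f) := by
      have h1 : Measurable (fun p : ℝ × ℝ => ((p.1 : ℝ) : ℂ) ^ s) :=
        (Complex.measurable_ofReal.comp measurable_fst).pow_const s
      have h2 : Measurable (fun p : ℝ × ℝ => ((ξ p.2 * Real.exp (-(p.1 * p.2)) : ℝ) : ℂ)) := by
        fun_prop
      exact h1.mul h2
    exact this.aestronglyMeasurable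
  have inner1 : ∀ u ∈ Ioi (0:ℝ), ∫ t, f u t ∂ν = (u : ℂ) ^ s * ((Real.exp (2 * J u) - 1 : ℝ) : ℂ) := by
    intro u hu
    simp only [f]
    rw [integral_const_mul, integral_complex_ofReal, hν, X_eq ξ hξ0 h u hu]
  have inner2 : ∀ t ∈ Ioi (1:ℝ), ∫ u, f u t ∂μ = Complex.Gamma (s + 1) * ((ξ t : ℂ) * (t : ℂ) ^ (-s - 1)) := by
    intro t ht
    have h1 : (1:ℝ) < t := ht
    have := Complex.integral_cpow_mul_exp_neg_mul_Ioi (a := s + 1) (r := t) (by simp; linarith) (by linarith)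
    have e : ∀ u, f u t = (ξ t : ℂ) * ((u:ℂ) ^ (s + 1 - 1) * Complex.exp (-(t * u))) := by
      intro u; simp only [f]; push_cast; rw [add_sub_cancel_right, mul_comm (u:ℂ) (t:ℂ)]; ring
    simp_rw [e]
    rw [integral_const_mul, hμ, this, one_div, Complex.inv_cpow, ← Complex.cpow_neg, neg_add']
    · ring
    · rw [Complex.arg_ofReal_of_nonneg (by linarith)]; exact Real.pi_pos.ne
  have nrm : ∀ t, ∀ u ∈ Ioi (0:ℝ), ‖f u t‖ = ξ t * (u ^ (s.re + 1 - 1) * Real.exp (-(t * u))) := by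
    intro t u hu
    simp only [f]
    rw [norm_mul, Complex.norm_cpow_eq_rpow_re_of_pos hu, Complex.norm_real, Real.norm_eq_abs,
      abs_of_nonneg (mul_nonneg (hb t).1 (Real.exp_pos _).le), add_sub_cancel_right, mul_comm u t]
    ring
  have inner3 : ∀ t ∈ Ioi (1:ℝ), ∫ u, ‖f u t‖ ∂μ = ξ t * ((1 / t) ^ (s.re + 1) * Real.Gamma (s.re + 1)) := by
    intro t ht
    have h1 : (1:ℝ) < t := ht
    rw [hμ, setIntegral_congr_fun measurableSet_Ioi (nrm t), integral_const_mul,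
      Real.integral_rpow_mul_exp_neg_mul_Ioi (by linarith) (by linarith)]
  have hfi : Integrable (Function.uncurry f) (μ.prod ν) := by
    rw [integrable_prod_iff' hfm]
    constructor
    · refine (ae_restrict_iff' measurableSet_Ioi).2 (.of_forall fun t ht => ?_)
      have h1 : (1:ℝ) < t := ht
      have hmt : Measurable (fun u => f u t) := by
        have h1 : Measurable (fun u : ℝ => (u : ℂ) ^ s) :=
          Complex.measurable_ofReal.pow_const s
        have h2 : Measurable (fun u : ℝ => ((ξ t * Real.exp (-(u * t)) : ℝ) : ℂ)) := by
          fun_prop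
        exact h1.mul h2
      simp only [Function.uncurry_apply_pair]
      rw [← integrable_norm_iff hmt.aestronglyMeasurable]
      have := (integrableOn_rpow_mul_exp_neg_mul_rpow (s := s.re) (p := 1) (b := t)
        (by linarith) one_pos (by linarith)).const_mul (ξ t)
      refine IntegrableOn.congr_fun this ?_ measurableSet_Ioi
      intro u hu
      simp only
      rw [nrm t u hu]; simp
    · have h1 := (integrableOn_Ioi_rpow_of_lt (a := -s.re) (c := 1) (by linarith) one_pos).const_mul
        (2 * Real.Gamma (s.re + 1))
      refine Integrable.mono' h1 hfm.norm.prod_swap.integral_prod_right' ?_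
      refine (ae_restrict_iff' measurableSet_Ioi).2 (.of_forall fun t ht => ?_)
      have h1 : (1:ℝ) < t := ht
      have hG : 0 < Real.Gamma (s.re + 1) := Real.Gamma_pos_of_pos (by linarith)
      show ‖∫ u, ‖f u t‖ ∂μ‖ ≤ _
      have h2 := (hb t).2
      rw [abs_of_pos (by linarith)] at h2
      rw [inner3 t ht, Real.norm_eq_abs, abs_of_nonneg (mul_nonneg (hb t).1 (by positivity))]
      calc _ ≤ (2 * t) * ((1 / t) ^ (s.re + 1) * Real.Gamma (s.re + 1)) :=
            mul_le_mul_of_nonneg_right h2 (by positivity)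
        _ = _ := by
          rw [one_div, Real.inv_rpow (by linarith), Real.rpow_add (by linarith), Real.rpow_one,
            Real.rpow_neg (by linarith)]
          field_simp
  constructor
  · refine Integrable.congr hfi.integral_prod_left ?_
    exact (ae_restrict_iff' measurableSet_Ioi).2 (.of_forall inner1)
  · have sw := integral_integral_swap hfi
    rw [← integral_const_mul, ← setIntegral_congr_fun measurableSet_Ioi inner1, ← setIntegral_congr_fun measurableSet_Ioi inner2]
    exact sw

lemma hhat_int (ξ : ℝ → ℝ) (hξ0 : ∀ u : ℝ, u < 1 → ξ u = 0)
    (h : ∀ u : ℝ, 1 ≤ u → u * ξ u = 2 + 2 * ∫ t in (1:ℝ)..(u - 1), ξ t) (s : ℂ) (hs : 1 < s.re) :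
    IntegrableOn (fun z : ℝ => ((ξ (Real.exp z - 1) : ℝ) : ℂ) * Complex.exp (-s * z)) (Set.Ioi 0) := by
  have hm := xi_measurable ξ hξ0 h
  have hb := xi_bound ξ hξ0 h
  have hi := (integrableOn_exp_mul_Ioi (a := 1 - s.re) (by linarith) 0).const_mul 2
  have hmm : Measurable (fun z : ℝ => ((ξ (Real.exp z - 1) : ℝ) : ℂ) * Complex.exp (-s * z)) := by
    fun_prop
  refine Integrable.mono' hi hmm.aestronglyMeasurable ?_
  refine (ae_restrict_iff' measurableSet_Ioi).2 (.of_forall fun z hz => ?_)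
  have hz : 0 < z := hz
  have h1 : 1 < Real.exp z := Real.one_lt_exp_iff.2 hz
  have h2 := (hb (Real.exp z - 1)).2
  rw [abs_of_pos (by linarith)] at h2
  rw [norm_mul, Complex.norm_real, Real.norm_eq_abs, abs_of_nonneg (hb _).1, Complex.norm_exp]
  have e : (-s * (z:ℂ)).re = -s.re * z := by simp
  rw [e, show (1 - s.re) * z = z + -s.re * z by ring, Real.exp_add, ← mul_assoc]
  exact mul_le_mul_of_nonneg_right (by linarith) (Real.exp_pos _).le

lemma hhat_eq (ξ : ℝ → ℝ) (hξ0 : ∀ u : ℝ, u < 1 → ξ u = 0) (s : ℂ) :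
    ∫ z in Set.Ioi (0:ℝ), ((ξ (Real.exp z - 1) : ℝ) : ℂ) * Complex.exp (-s * z)
      = ∫ v in Ioi (1:ℝ), (ξ v : ℂ) * ((v + 1 : ℝ) : ℂ) ^ (-s - 1) := by
  have im : (fun z : ℝ => Real.exp z - 1) '' Ioi 0 = Ioi 0 := by
    ext v
    constructor
    · rintro ⟨z, hz, rfl⟩
      have : 1 < Real.exp z := Real.one_lt_exp_iff.2 hz
      show 0 < Real.exp z - 1
      linarith
    · intro hv
      have hv : 0 < v := hv
      refine ⟨Real.log (v + 1), Real.log_pos (by linarith), ?_⟩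
      simp only
      rw [Real.exp_log (by linarith)]; ring
  have cv := integral_image_eq_integral_abs_deriv_smul (s := Ioi (0:ℝ)) (f := fun z : ℝ => Real.exp z - 1)
    (f' := Real.exp) measurableSet_Ioi
    (fun x _ => ((Real.hasDerivAt_exp x).sub_const 1).hasDerivWithinAt)
    (fun a _ b _ hab => Real.exp_injective (by simpa using hab))
    (fun v => (ξ v : ℂ) * ((v + 1 : ℝ) : ℂ) ^ (-s - 1))
  rw [im] at cv
  have e1 : ∫ v in Ioi (1:ℝ), (ξ v : ℂ) * ((v + 1 : ℝ) : ℂ) ^ (-s - 1)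
      = ∫ v in Ioi (0:ℝ), (ξ v : ℂ) * ((v + 1 : ℝ) : ℂ) ^ (-s - 1) := by
    rw [← integral_Ici_eq_integral_Ioi]
    refine (setIntegral_eq_of_subset_of_forall_sdiff_eq_zero measurableSet_Ioi ?_ ?_).symm
    · intro x hx
      have : (1:ℝ) ≤ x := hx
      show 0 < x
      linarith
    · intro x hx
      have : ¬ (1:ℝ) ≤ x := hx.2
      rw [hξ0 x (by linarith)]; simp
  rw [e1, cv]
  refine setIntegral_congr_fun measurableSet_Ioi fun z _ => ?_
  rw [sub_add_cancel, Real.abs_exp, Complex.real_smul, Complex.cpow_def_of_ne_zero (by simp),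
    ← Complex.ofReal_log (Real.exp_pos z).le, Real.log_exp, mul_left_comm, Complex.ofReal_exp, ← Complex.exp_add]
  congr 2; ring

lemma mellin_rec (ξ : ℝ → ℝ) (hξ0 : ∀ u : ℝ, u < 1 → ξ u = 0)
    (h : ∀ u : ℝ, 1 ≤ u → u * ξ u = 2 + 2 * ∫ t in (1:ℝ)..(u - 1), ξ t) (s : ℂ) (hs : 1 < s.re) :
    (s + 1) * ∫ t in Ioi (1:ℝ), (ξ t : ℂ) * (t : ℂ) ^ (-s - 1)
      = 2 * (1 + ∫ v in Ioi (1:ℝ), (ξ v : ℂ) * ((v + 1 : ℝ) : ℂ) ^ (-s - 1)) := by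
  have hs1 : s + 1 ≠ 0 := by
    intro h0
    have := congrArg Complex.re h0
    simp at this; linarith
  have hf := fubini_xi ξ hξ0 h (fun t => (t : ℂ) ^ (-s - 2))
    ((Complex.measurable_ofReal.pow_const _).aestronglyMeasurable) ?_
  · have hI : ∀ c : ℝ, 0 < c → ∫ t in Ioi c, (t : ℂ) ^ (-s - 2) = (c : ℂ) ^ (-s - 1) / (s + 1) := by
      intro c hc
      rw [integral_Ioi_cpow_of_lt (by simp; linarith) hc, show -s - 2 + 1 = -s - 1 by ring,
        show -s - 1 = -(s + 1) by ring, neg_div_neg_eq]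
    have e1 : ∫ t in Ioi (1:ℝ), (ξ t : ℂ) * (t : ℂ) ^ (-s - 1) = ∫ t in Ioi (1:ℝ), (t * ξ t) • (t : ℂ) ^ (-s - 2) := by
      refine setIntegral_congr_fun measurableSet_Ioi fun t ht => ?_
      have ht : (1:ℝ) < t := ht
      have h0 : (t:ℂ) ≠ 0 := by
        rw [Ne, Complex.ofReal_eq_zero]; linarith
      rw [show -s - 1 = 1 + (-s - 2) by ring, Complex.cpow_add _ _ h0, Complex.cpow_one, Complex.real_smul]
      push_cast; ring
    have e2 : ∫ v in Ioi (1:ℝ), ξ v • ∫ t in Ioi (v + 1), (t : ℂ) ^ (-s - 2)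
        = (∫ v in Ioi (1:ℝ), (ξ v : ℂ) * ((v + 1 : ℝ) : ℂ) ^ (-s - 1)) / (s + 1) := by
      rw [← integral_div]
      refine setIntegral_congr_fun measurableSet_Ioi fun v hv => ?_
      have hv : (1:ℝ) < v := hv
      rw [hI _ (by linarith), Complex.real_smul]; ring
    rw [e1, hf, e2, hI 1 one_pos, Complex.ofReal_one, Complex.one_cpow, Complex.real_smul, Complex.real_smul]
    field_simp
    push_cast; ring
  · refine (integrableOn_Ioi_rpow_of_lt (a := -s.re) (c := 1) (by linarith) one_pos).congr_fun ?_ measurableSet_Ioi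
    intro t ht
    have ht : (1:ℝ) < t := ht
    simp only
    rw [Complex.norm_cpow_eq_rpow_re_of_pos (by linarith), ← Real.rpow_two, ← Real.rpow_add (by linarith)]
    congr 1; simp

theorem Q_eq_Gamma_times_laplace (ξ : ℝ → ℝ)
    (hξ0 : ∀ u : ℝ, u < 1 → ξ u = 0)
    (hξ : ∀ u : ℝ, 1 ≤ u → u * ξ u = 2 + 2 * ∫ t in (1:ℝ)..(u - 1), ξ t) :
    ∀ s : ℂ, 1 < s.re →
      IntegrableOn (fun u : ℝ => (u : ℂ) ^ s * ((Real.exp (2 * J u) - 1 : ℝ) : ℂ))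
        (Set.Ioi 0) ∧
      IntegrableOn (fun z : ℝ => ((ξ (Real.exp z - 1) : ℝ) : ℂ) * Complex.exp (-s * z))
        (Set.Ioi 0) ∧
      (s + 1) * ∫ u in Set.Ioi (0:ℝ), (u : ℂ) ^ s * ((Real.exp (2 * J u) - 1 : ℝ) : ℂ) =
        2 * Complex.Gamma (s + 1) *
          (1 + ∫ z in Set.Ioi (0:ℝ),
            ((ξ (Real.exp z - 1) : ℝ) : ℂ) * Complex.exp (-s * z)) := by
  intro s hs
  obtain ⟨h1, h2⟩ := mellin_part ξ hξ0 hξ s hs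
  refine ⟨h1, hhat_int ξ hξ0 hξ s hs, ?_⟩
  rw [h2, hhat_eq ξ hξ0 s, mul_left_comm, mellin_rec ξ hξ0 hξ s hs]
  ring
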